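/- Let d ≥ 1, n := d(d+1)/2, τ* := n+1, let ḡ be an admissible metric, i.e. a symmetric positive-definite bilinear form on ℝ^d for which there is γ₀ > 0 with |Σ_{i≤j} ḡ_{ij} ℓ_{ij}| ≥ γ₀·(Σ_{i≤j}|ℓ_{ij}|)^{−τ*} for every nonzero integer vector ℓ ∈ ℤ^n, and fix 0 < ζ₁ < ζ₂ and r ∈ ℕ. Define Ω_j(ζ) := |j|_ḡ · √(|j|_ḡ² + ζ) for j ∈ ℤ^d ∖ {0}. Then there exists τ (depending on r) with the following property: for every sufficiently small γ > 0 there exist a measurable set I_γ ⊂ (ζ₁,ζ₂) and a constant C > 0 such that the Lebesgue measure of (ζ₁,ζ₂) ∖ I_γ is at most C γ^{1/r}, and for every ζ ∈ I_γ, every N ≥ 1, every j₁,…,j_r ∈ ℤ^d ∖ {0} with |j_l| ≤ N for all l, and every choice of signs σ_l ∈ {−1,+1}: if Σ_{l=1}^r σ_l Ω_{j_l}(ζ) ≠ 0 then |Σ_{l=1}^r σ_l Ω_{j_l}(ζ)| ≥ γ / N^{τ}. -/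

import Mathlib

open scoped BigOperators

namespace AG

abbrev Zd (d : ℕ) := Fin d → ℤ

noncomputable def enorm {d : ℕ} (j : Zd d) : ℝ := Real.sqrt (∑ i, ((j i : ℝ))^2)

/-- `|j|_g² = g(j,j)` for a quadratic form with coefficients `g`. -/
noncomputable def qform (d : ℕ) (g : Fin d → Fin d → ℝ) (j : Zd d) : ℝ :=
  ∑ i, ∑ k, g i k * (j i : ℝ) * (j k : ℝ)

/-- `τ* = d(d+1)/2 + 1`. -/
def tauStar (d : ℕ) : ℕ := d * (d + 1) / 2 + 1

/-- `g` is an admissible (γ-diophantine) metric: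
`|Σ_{i≤j} g_{ij} ℓ_{ij}| ≥ γ (Σ_{i≤j}|ℓ_{ij}|)^{−τ*}` for all nonzero `ℓ ∈ ℤ^{d(d+1)/2}`. -/
def Diophantine (d : ℕ) (g : Fin d → Fin d → ℝ) (γ : ℝ) : Prop :=
  ∀ ℓ : Fin d → Fin d → ℤ, (∃ i j, i ≤ j ∧ ℓ i j ≠ 0) →
    γ / (∑ i, ∑ j, if i ≤ j then (|ℓ i j| : ℝ) else 0) ^ tauStar d ≤
      |∑ i, ∑ j, if i ≤ j then g i j * (ℓ i j : ℝ) else 0|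

/-- The (rescaled) QHD frequencies `Ω_j(ζ) = |j|_ḡ √(|j|_ḡ² + ζ)`. -/
noncomputable def qhdFreq (d : ℕ) (gbar : Fin d → Fin d → ℝ) (j : Zd d) (ζ : ℝ) : ℝ :=
  Real.sqrt (qform d gbar j) * Real.sqrt (qform d gbar j + ζ)

lemma rpow_bd (T X s : ℝ) (R : ℕ) (hT : 1 ≤ T) (h1 : T⁻¹ ≤ X) (h2 : X ≤ T) (hs : |s| ≤ R) :
    X ^ s ≤ T ^ R := by
  have hT0 : 0 < T := by linarith
  have hX : 0 < X := lt_of_lt_of_le (inv_pos.2 hT0) h1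
  rw [← Real.rpow_natCast]
  obtain ⟨h3, h4⟩ := abs_le.1 hs
  rcases le_total 0 s with h | h
  · exact (Real.rpow_le_rpow hX.le h2 h).trans (Real.rpow_le_rpow_of_exponent_le hT h4)
  · have : X ^ s ≤ (T⁻¹) ^ s := Real.rpow_le_rpow_of_nonpos (inv_pos.2 hT0) h1 h
    rw [Real.inv_rpow hT0.le, ← Real.rpow_neg hT0.le] at this
    exact this.trans (Real.rpow_le_rpow_of_exponent_le hT (by linarith))

lemma deriv_core (S : Finset ℝ) (c : ℝ → ℝ) (s a z : ℝ) (hpos : ∀ k ∈ S, 0 < k + z)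
    (ha : 0 < a + z) :
    HasDerivAt (fun z => (∑ k ∈ S, c k * (k + z) ^ s) * (a + z) ^ (-s))
      ((a + z) ^ (-s - 1) * ∑ k ∈ S, (c k * (s * (a - k))) * (k + z) ^ (s - 1)) z := by
  have h1 : ∀ k ∈ S, HasDerivAt (fun z => c k * (k + z) ^ s) (c k * (1 * s * (k + z) ^ (s - 1))) z := by
    intro k hk
    exact (((hasDerivAt_id z).const_add k).rpow_const (Or.inl (hpos k hk).ne')).const_mul (c k)
  have h2 : HasDerivAt (fun z => (a + z) ^ (-s)) (1 * (-s) * (a + z) ^ (-s - 1)) z :=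
    ((hasDerivAt_id z).const_add a).rpow_const (Or.inl ha.ne')
  have h3 := (HasDerivAt.fun_sum h1).mul h2
  refine h3.congr_deriv ?_
  have e1 : (a + z) ^ (-s) = (a + z) ^ (-s - 1) * (a + z) := by
    conv_rhs => rw [← Real.rpow_add_one ha.ne']
    congr 1; ring
  rw [e1, Finset.sum_mul, Finset.sum_mul, ← Finset.sum_add_distrib, Finset.mul_sum]
  refine Finset.sum_congr rfl fun k hk => ?_
  have e2 : (k + z) ^ s = (k + z) ^ (s - 1) * (k + z) := by
    conv_rhs => rw [← Real.rpow_add_one (hpos k hk).ne']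
    congr 1; ring
  rw [e2]; ring

lemma core (δ ρ T u v : ℝ) (R : ℕ) (hδ : 0 < δ) (hρ : 0 < ρ) (hT : 1 ≤ T) :
    ∀ n : ℕ, ∀ (S : Finset ℝ) (c : ℝ → ℝ) (m : ℕ) (ε : ℝ) (p : ℕ → ℝ) (b : ℝ), b ∈ S →
      S.card = n + 1 → m + n + 1 ≤ R →
      (∀ a ∈ S, ∀ a' ∈ S, a ≠ a' → ρ ≤ |a - a'|) →
      (∀ a ∈ S, ∀ z ∈ Set.Icc u v, T⁻¹ ≤ a + z ∧ a + z ≤ T) →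
      (∀ i < 2 ^ n, p i ∈ Set.Icc u v ∧ |∑ a ∈ S, c a * (a + p i) ^ ((1 / 2 : ℝ) - m)| ≤ ε) →
      (∀ i, i + 1 < 2 ^ n → p i + δ ≤ p (i + 1)) →
      |c b| ≤ ε * T ^ R * (4 * T ^ (2 * R + 1) / (δ * ρ)) ^ n := by
  have hT0 : 0 < T := by linarith
  intro n
  induction n with
  | zero =>
    intro S c m ε p b hb hS hm _ hX hp _
    obtain ⟨x, rfl⟩ := Finset.card_eq_one.1 hS
    obtain rfl : b = x := by simpa using hb
    obtain ⟨h1, h2⟩ := hp 0 (by simp)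
    obtain ⟨h3, h4⟩ := hX b hb _ h1
    rw [Finset.sum_singleton, abs_mul] at h2
    have hpos : 0 < b + p 0 := lt_of_lt_of_le (inv_pos.2 hT0) h3
    have h5 := rpow_bd T (b + p 0) (-((1 / 2 : ℝ) - m)) R hT h3 h4 (by
      have : (m : ℝ) + 1 ≤ R := by exact_mod_cast (by omega : m + 1 ≤ R)
      have := (Nat.cast_nonneg m : (0:ℝ) ≤ m)
      rw [abs_le]; constructor <;> linarith)
    have h6 : (b + p 0) ^ ((1 / 2 : ℝ) - m) * (b + p 0) ^ (-((1 / 2 : ℝ) - m)) = 1 := by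
      rw [← Real.rpow_add hpos]; simp
    rw [abs_of_pos (Real.rpow_pos_of_pos hpos _)] at h2
    have hε : 0 ≤ ε := le_trans (by positivity) h2
    simp only [pow_zero, mul_one]
    calc |c b| = (|c b| * (b + p 0) ^ ((1 / 2 : ℝ) - m)) * (b + p 0) ^ (-((1 / 2 : ℝ) - m)) := by
          rw [mul_assoc, h6, mul_one]
      _ ≤ ε * T ^ R := by gcongr
  | succ n ih =>
    intro S c m ε p b hb hS hm hsep hX hp hgap
    obtain ⟨a, ha, hab⟩ : ∃ a ∈ S, a ≠ b := by
      have : 1 < S.card := by omega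
      exact Finset.exists_mem_ne this b
    set s : ℝ := (1 / 2 : ℝ) - m with hs
    have hmR : (m : ℝ) + 2 ≤ R := by exact_mod_cast (by omega : m + 2 ≤ R)
    have hm0 := (Nat.cast_nonneg m : (0:ℝ) ≤ m)
    have hsR : |s| ≤ R := by rw [abs_le]; constructor <;> linarith
    have hs2 : (1 / 2 : ℝ) ≤ |s| := by
      rcases Nat.eq_zero_or_pos m with h | h
      · subst h; rw [hs]; norm_num
      · have : (1 : ℝ) ≤ m := by exact_mod_cast h
        rw [abs_of_nonpos (by linarith)]; linarith
    have hε : 0 ≤ ε := (abs_nonneg _).trans (hp 0 (by positivity)).2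
    have hposX : ∀ k ∈ S, ∀ z ∈ Set.Icc u v, 0 < k + z := fun k hk z hz =>
      lt_of_lt_of_le (inv_pos.2 hT0) (hX k hk z hz).1
    -- the intermediate points
    have key : ∀ i < 2 ^ n, ∃ q, p (2 * i) ≤ q ∧ q ≤ p (2 * i + 1) ∧ q ∈ Set.Icc u v ∧
        |∑ k ∈ S.erase a, (c k * (s * (a - k))) * (k + q) ^ (s - 1)| ≤
          2 * ε * T ^ (2 * R + 1) / δ := by
      intro i hi
      have hpw : 2 ^ (n + 1) = 2 * 2 ^ n := by ring
      obtain ⟨h1, h1'⟩ := hp (2 * i) (by omega)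
      obtain ⟨h2, h2'⟩ := hp (2 * i + 1) (by omega)
      have hg := hgap (2 * i) (by omega)
      have hlt : p (2 * i) < p (2 * i + 1) := by linarith
      have hsub : Set.Icc (p (2 * i)) (p (2 * i + 1)) ⊆ Set.Icc u v :=
        Set.Icc_subset_Icc h1.1 h2.2
      have hd : ∀ z ∈ Set.Icc (p (2 * i)) (p (2 * i + 1)), _ := fun z hz =>
        deriv_core S c s a z (fun k hk => hposX k hk z (hsub hz)) (hposX a ha z (hsub hz))
      obtain ⟨q, hq, hq'⟩ := exists_hasDerivAt_eq_slope _ _ hlt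
        (fun z hz => (hd z hz).continuousAt.continuousWithinAt)
        (fun z hz => hd z (Set.Ioo_subset_Icc_self hz))
      have hqI := hsub (Set.Ioo_subset_Icc_self hq)
      refine ⟨q, hq.1.le, hq.2.le, hqI, ?_⟩
      have hbd : ∀ z ∈ Set.Icc u v, |∑ k ∈ S, c k * (k + z) ^ s| ≤ ε →
          |(∑ k ∈ S, c k * (k + z) ^ s) * (a + z) ^ (-s)| ≤ ε * T ^ R := by
        intro z hz hz'
        have hp0 := hposX a ha z hz
        rw [abs_mul, abs_of_pos (Real.rpow_pos_of_pos hp0 _)]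
        have := rpow_bd T (a + z) (-s) R hT (hX a ha z hz).1 (hX a ha z hz).2 (by rwa [abs_neg])
        gcongr
      have e1 := hbd _ h1 h1'
      have e2 := hbd _ h2 h2'
      set A := (∑ k ∈ S, c k * (k + p (2 * i)) ^ s) * (a + p (2 * i)) ^ (-s)
      set B := (∑ k ∈ S, c k * (k + p (2 * i + 1)) ^ s) * (a + p (2 * i + 1)) ^ (-s)
      have hslope : |(B - A) / (p (2 * i + 1) - p (2 * i))| ≤ 2 * ε * T ^ R / δ := by
        rw [abs_div]
        have : |B - A| ≤ 2 * ε * T ^ R := (abs_sub B A).trans (by linarith)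
        have h5 : δ ≤ |p (2 * i + 1) - p (2 * i)| := by
          rw [abs_of_pos (by linarith)]; linarith
        gcongr
      have hera : ∑ k ∈ S.erase a, (c k * (s * (a - k))) * (k + q) ^ (s - 1)
          = ∑ k ∈ S, (c k * (s * (a - k))) * (k + q) ^ (s - 1) := by
        rw [← Finset.add_sum_erase S _ ha]; simp
      rw [hera]
      have hqa := hposX a ha q hqI
      have h7 := rpow_bd T (a + q) (-(-s - 1)) (R + 1) hT (hX a ha q hqI).1 (hX a ha q hqI).2 (by
        push_cast
        rw [abs_le] at hsR ⊢; constructor <;> linarith)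
      have h8 : (a + q) ^ (-(-s - 1)) * (a + q) ^ (-s - 1) = 1 := by
        rw [← Real.rpow_add hqa, neg_add_cancel, Real.rpow_zero]
      set Q := ∑ k ∈ S, (c k * (s * (a - k))) * (k + q) ^ (s - 1)
      calc |Q| = |(a + q) ^ (-(-s - 1)) * ((a + q) ^ (-s - 1) * Q)| := by
            rw [← mul_assoc, h8, one_mul]
        _ = (a + q) ^ (-(-s - 1)) * |(B - A) / (p (2 * i + 1) - p (2 * i))| := by
            rw [abs_mul, hq', abs_of_pos (Real.rpow_pos_of_pos hqa _)]
        _ ≤ T ^ (R + 1) * (2 * ε * T ^ R / δ) := by gcongr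
        _ = _ := by ring
    choose! q hq1 hq2 hq3 hq4 using key
    have hpw : 2 ^ (n + 1) = 2 * 2 ^ n := by ring
    have hI := ih (S.erase a) (fun k => c k * (s * (a - k))) (m + 1)
      (2 * ε * T ^ (2 * R + 1) / δ) q b (Finset.mem_erase.2 ⟨hab.symm, hb⟩)
      (by rw [Finset.card_erase_of_mem ha]; omega) (by omega)
      (fun x hx y hy => hsep x (Finset.mem_of_mem_erase hx) y (Finset.mem_of_mem_erase hy))
      (fun x hx => hX x (Finset.mem_of_mem_erase hx))
      (fun i hi => ⟨hq3 i hi, by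
        have e : (1 / 2 : ℝ) - ((m + 1 : ℕ) : ℝ) = s - 1 := by rw [hs]; push_cast; ring
        rw [e]; exact hq4 i hi⟩)
      (fun i hi => by
        have a1 := hq2 i (by omega)
        have a2 := hq1 (i + 1) hi
        have a3 := hgap (2 * i + 1) (by omega)
        have : 2 * (i + 1) = 2 * i + 1 + 1 := by ring
        rw [this] at a2
        linarith)
    have hlow : |c b| * (ρ / 2) ≤ |c b * (s * (a - b))| := by
      rw [abs_mul, abs_mul]
      have := hsep a ha b hb hab
      have : 1 / 2 * ρ ≤ |s| * |a - b| := by gcongr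
      have h9 := mul_le_mul_of_nonneg_left this (abs_nonneg (c b))
      linarith
    have h10 := hlow.trans hI
    have h11 : |c b| ≤ (2 * ε * T ^ (2 * R + 1) / δ * T ^ R * (4 * T ^ (2 * R + 1) / (δ * ρ)) ^ n) / (ρ / 2) := by
      rw [le_div_iff₀ (by positivity)]; exact h10
    refine h11.trans (le_of_eq ?_)
    rw [pow_succ (4 * T ^ (2 * R + 1) / (δ * ρ)) n]
    generalize (4 * T ^ (2 * R + 1) / (δ * ρ)) ^ n = Z
    field_simp
    ring

open MeasureTheory in
lemma greedy (δ u : ℝ) (hδ : 0 < δ) : ∀ (M : ℕ) (E : Set ℝ), (∀ x ∈ E, u ≤ x) →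
    ENNReal.ofReal (2 * M * δ) < volume E →
    ∃ p : ℕ → ℝ, (∀ i ≤ M, p i ∈ E) ∧ ∀ i, i < M → p i + δ ≤ p (i + 1) := by
  intro M
  induction M with
  | zero =>
    intro E _ hE
    have : E.Nonempty := by
      rw [Set.nonempty_iff_ne_empty]; rintro rfl; simp at hE
    obtain ⟨x, hx⟩ := this
    exact ⟨fun _ => x, fun _ _ => hx, fun i hi => by omega⟩
  | succ M ih =>
    intro E hu hE
    have hne : E.Nonempty := by
      rw [Set.nonempty_iff_ne_empty]; rintro rfl; simp at hE
    obtain ⟨x, hx, hx'⟩ := exists_lt_of_csInf_lt hne (lt_add_of_pos_right (sInf E) hδ)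
    have hbdd : BddBelow E := ⟨u, fun y hy => hu y hy⟩
    have hsub : E ⊆ (E ∩ Set.Ici (x + δ)) ∪ Set.Ico (sInf E) (sInf E + 2 * δ) := by
      intro y hy
      by_cases h : x + δ ≤ y
      · exact Or.inl ⟨hy, h⟩
      · exact Or.inr ⟨csInf_le hbdd hy, by push Not at h; linarith⟩
    have hvol : ENNReal.ofReal (2 * M * δ) < volume (E ∩ Set.Ici (x + δ)) := by
      by_contra hcon
      push Not at hcon
      have := (measure_mono hsub).trans (measure_union_le (μ := volume) _ _)
      rw [Real.volume_Ico] at this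
      have h2 := this.trans (add_le_add_left hcon _)
      rw [← ENNReal.ofReal_add (by positivity) (by linarith)] at h2
      refine absurd (hE.trans_le h2) ?_
      push Not
      refine ENNReal.ofReal_le_ofReal ?_
      push_cast; linarith
    obtain ⟨p, hp1, hp2⟩ := ih _ (fun y hy => hu y hy.1) hvol
    refine ⟨fun i => Nat.casesOn i x p, ?_, ?_⟩
    · intro i hi
      cases i with
      | zero => exact hx
      | succ i => exact (hp1 i (by omega)).1
    · intro i hi
      cases i with
      | zero => exact (hp1 0 (by omega)).2
      | succ i => exact hp2 i (by omega)

lemma coord_le {d : ℕ} (j : Zd d) (N : ℕ) (h : enorm j ≤ N) (i : Fin d) : |(j i : ℝ)| ≤ N := by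
  refine le_trans ?_ h
  unfold enorm
  rw [← Real.sqrt_sq_eq_abs]
  exact Real.sqrt_le_sqrt (Finset.single_le_sum (f := fun i => ((j i : ℝ)) ^ 2)
    (fun _ _ => sq_nonneg _) (Finset.mem_univ i))

/-- upper triangular coefficients of `x ↦ g(x,x)` -/
def tri {d : ℕ} (j : Zd d) (i k : Fin d) : ℤ := if i = k then j i * j k else 2 * (j i * j k)

lemma qform_tri {d : ℕ} (g : Fin d → Fin d → ℝ) (hsym : ∀ i k, g i k = g k i) (j : Zd d) :
    qform d g j = ∑ i, ∑ k, if i ≤ k then g i k * (tri j i k : ℝ) else 0 := by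
  have h1 : qform d g j = ∑ i, ∑ k, ((if i ≤ k then g i k * j i * j k else 0) +
      (if k < i then g i k * (j i : ℝ) * j k else 0)) := by
    unfold qform
    refine Finset.sum_congr rfl fun i _ => Finset.sum_congr rfl fun k _ => ?_
    rcases le_or_gt i k with h | h
    · simp [h, not_lt.2 h]
    · simp [h, not_le.2 h]
  have h2 : ∑ i, ∑ k, (if k < i then g i k * (j i : ℝ) * j k else 0)
      = ∑ i, ∑ k, (if i < k then g i k * (j i : ℝ) * j k else 0) := by
    rw [Finset.sum_comm]
    refine Finset.sum_congr rfl fun i _ => Finset.sum_congr rfl fun k _ => ?_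
    rw [hsym k i]; congr 1; ring
  simp only [Finset.sum_add_distrib] at h1
  rw [h1, h2]
  simp only [← Finset.sum_add_distrib]
  refine Finset.sum_congr rfl fun i _ => Finset.sum_congr rfl fun k _ => ?_
  unfold tri
  rcases lt_trichotomy i k with h | h | h
  · simp only [h, h.le, h.ne, if_true, if_false]; push_cast; ring
  · subst h; simp; ring
  · simp [not_le.2 h, not_lt.2 h.le]

lemma tri_le {d : ℕ} (j : Zd d) (N : ℕ) (h : ∀ i, |(j i : ℝ)| ≤ N) (i k : Fin d) :
    |(tri j i k : ℝ)| ≤ 2 * (N : ℝ) ^ 2 := by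
  have h1 : |(j i : ℝ) * j k| ≤ (N : ℝ) ^ 2 := by
    rw [abs_mul, sq]; exact mul_le_mul (h i) (h k) (abs_nonneg _) (by positivity)
  unfold tri
  split_ifs
  · push_cast; have := sq_nonneg (N : ℝ); linarith
  · push_cast; rw [abs_mul]; simpa using h1

lemma dioph_sep {d : ℕ} (hd : 1 ≤ d) (g : Fin d → Fin d → ℝ) (hsym : ∀ i k, g i k = g k i)
    (γ₀ : ℝ) (h0 : 0 < γ₀) (hD : Diophantine d g γ₀) (N : ℕ) (hN : 1 ≤ N) (j j' : Zd d)
    (hj : ∀ i, |(j i : ℝ)| ≤ N) (hj' : ∀ i, |(j' i : ℝ)| ≤ N) (hne : qform d g j ≠ qform d g j') :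
    γ₀ / (4 * (d : ℝ) ^ 2) ^ tauStar d / (N : ℝ) ^ (2 * tauStar d)
      ≤ |qform d g j - qform d g j'| := by
  have hdiff : qform d g j - qform d g j' =
      ∑ i, ∑ k, if i ≤ k then g i k * ((tri j i k - tri j' i k : ℤ) : ℝ) else 0 := by
    rw [qform_tri g hsym, qform_tri g hsym]
    simp only [← Finset.sum_sub_distrib]
    refine Finset.sum_congr rfl fun i _ => Finset.sum_congr rfl fun k _ => ?_
    split_ifs <;> push_cast <;> ring
  have hex : ∃ i k : Fin d, i ≤ k ∧ tri j i k - tri j' i k ≠ 0 := by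
    by_contra hcon
    push Not at hcon
    apply hne
    rw [← sub_eq_zero, hdiff]
    refine Finset.sum_eq_zero fun i _ => Finset.sum_eq_zero fun k _ => ?_
    split_ifs with h
    · rw [hcon i k h]; simp
    · rfl
  have hmain := hD (fun i k => tri j i k - tri j' i k) hex
  rw [← hdiff] at hmain
  refine le_trans ?_ hmain
  set Sg := ∑ i, ∑ k, if i ≤ k then |((tri j i k - tri j' i k : ℤ) : ℝ)| else 0 with hSg
  have hS0 : 0 < Sg := by
    obtain ⟨i, k, hik, hne'⟩ := hex
    have hn : ∀ i k : Fin d, 0 ≤ if i ≤ k then |((tri j i k - tri j' i k : ℤ) : ℝ)| else 0 := by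
      intro i k; split_ifs <;> positivity
    refine Finset.sum_pos' (fun i _ => Finset.sum_nonneg fun k _ => hn i k) ⟨i, Finset.mem_univ _, ?_⟩
    refine Finset.sum_pos' (fun k _ => hn i k) ⟨k, Finset.mem_univ _, ?_⟩
    rw [if_pos hik, abs_pos]; exact_mod_cast hne'
  have hS1 : Sg ≤ 4 * (d : ℝ) ^ 2 * (N : ℝ) ^ 2 := by
    have : Sg ≤ ∑ i : Fin d, ∑ k : Fin d, 4 * (N : ℝ) ^ 2 := by
      refine Finset.sum_le_sum fun i _ => Finset.sum_le_sum fun k _ => ?_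
      split_ifs
      · push_cast
        refine (abs_sub _ _).trans ?_
        have := tri_le j N hj i k
        have := tri_le j' N hj' i k
        linarith
      · positivity
    refine this.trans (le_of_eq ?_)
    simp; ring
  rw [div_div, pow_mul, ← mul_pow]
  gcongr

lemma qform_le {d : ℕ} (g : Fin d → Fin d → ℝ) (N : ℕ) (j : Zd d) (hj : ∀ i, |(j i : ℝ)| ≤ N) :
    qform d g j ≤ (∑ i, ∑ k, |g i k|) * (N : ℝ) ^ 2 := by
  unfold qform
  simp only [Finset.sum_mul]
  refine Finset.sum_le_sum fun i _ => Finset.sum_le_sum fun k _ => ?_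
  refine (le_abs_self _).trans ?_
  rw [abs_mul, abs_mul, sq, mul_assoc]
  gcongr
  · exact hj i
  · exact hj k

open MeasureTheory in
/-- measure of a single bad set -/
lemma single_bad {r d : ℕ} (g : Fin d → Fin d → ℝ) (j : Fin r → Zd d) (σ : Fin r → ℤ)
    (δ ρ T ε ζ₁ ζ₂ : ℝ) (hδ : 0 < δ) (hδ1 : δ ≤ 1) (hρ : 0 < ρ) (hρ1 : ρ ≤ 1) (hT : 1 ≤ T)
    (hε : 0 < ε)
    (hlow : ∀ l, ρ ≤ qform d g (j l))
    (hsep : ∀ l l', qform d g (j l) ≠ qform d g (j l') → ρ ≤ |qform d g (j l) - qform d g (j l')|)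
    (hX : ∀ l, ∀ z ∈ Set.Icc ζ₁ ζ₂, T⁻¹ ≤ qform d g (j l) + z ∧ qform d g (j l) + z ≤ T)
    (hsmall : ε * T ^ (r + 1) * (4 * T ^ (2 * (r + 1) + 1) / (δ * ρ)) ^ (r - 1) < ρ) :
    volume {ζ | ζ ∈ Set.Ioo ζ₁ ζ₂ ∧ (∑ l, (σ l : ℝ) * qhdFreq d g (j l) ζ) ≠ 0 ∧
      |∑ l, (σ l : ℝ) * qhdFreq d g (j l) ζ| < ε} ≤ ENNReal.ofReal (2 * (2 ^ r : ℕ) * δ) := by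
  classical
  by_contra hcon
  push Not at hcon
  obtain ⟨p, hp1, hp2⟩ := greedy δ ζ₁ hδ (2 ^ r) _ (fun x hx => hx.1.1.le) hcon
  set a : Fin r → ℝ := fun l => qform d g (j l) with ha
  set S : Finset ℝ := Finset.univ.image a with hS
  set c : ℝ → ℝ := fun b => ((∑ l with a l = b, σ l : ℤ) : ℝ) * Real.sqrt b with hc
  have hf : ∀ ζ, ∑ l, (σ l : ℝ) * qhdFreq d g (j l) ζ
      = ∑ b ∈ S, c b * (b + ζ) ^ ((1 / 2 : ℝ) - (0 : ℕ)) := by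
    intro ζ
    rw [← Finset.sum_fiberwise_of_maps_to (s := Finset.univ) (t := S) (g := a)
      (fun l _ => Finset.mem_image_of_mem _ (Finset.mem_univ l))]
    refine Finset.sum_congr rfl fun b _ => ?_
    simp only [hc]
    push_cast
    rw [Finset.sum_mul, Finset.sum_mul]
    refine Finset.sum_congr rfl fun l hl => ?_
    have : a l = b := (Finset.mem_filter.1 hl).2
    unfold qhdFreq
    change (σ l : ℝ) * (√(a l) * √(a l + ζ)) = _
    rw [this, sub_zero, ← Real.sqrt_eq_rpow]; ring
  obtain ⟨b, hb, hcb⟩ : ∃ b ∈ S, c b ≠ 0 := by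
    by_contra h
    push Not at h
    have h3 := (hp1 0 (by positivity)).2.1
    rw [hf] at h3
    exact h3 (Finset.sum_eq_zero fun b hb => by rw [h b hb, zero_mul])
  have hcard : S.card ≤ r := by simpa using (Finset.card_image_le (s := Finset.univ) (f := a))
  have hcard0 : 0 < S.card := Finset.card_pos.2 ⟨b, hb⟩
  have hbρ : ρ ≤ b := by
    obtain ⟨l, -, rfl⟩ := Finset.mem_image.1 hb; exact hlow l
  have hcb' : ρ ≤ |c b| := by
    have hz : (∑ l with a l = b, σ l) ≠ 0 := by
      intro h; apply hcb; simp only [hc]; rw [h]; simp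
    have h1 : (1 : ℝ) ≤ |((∑ l with a l = b, σ l : ℤ) : ℝ)| := by
      exact_mod_cast Int.one_le_abs hz
    have h2 : ρ ≤ √b := by
      refine Real.le_sqrt_of_sq_le ?_
      nlinarith
    simp only [hc]
    rw [abs_mul, abs_of_nonneg (Real.sqrt_nonneg b)]
    nlinarith
  have hpw : 2 ^ (S.card - 1) ≤ 2 ^ r := Nat.pow_le_pow_right (by norm_num) (by omega)
  have hmain := core δ ρ T ζ₁ ζ₂ (r + 1) hδ hρ hT (S.card - 1) S c 0 ε p b hb (by omega) (by omega)
    (by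
      intro x hx y hy hxy
      obtain ⟨l, -, rfl⟩ := Finset.mem_image.1 hx
      obtain ⟨l', -, rfl⟩ := Finset.mem_image.1 hy
      exact hsep l l' hxy)
    (by
      intro x hx
      obtain ⟨l, -, rfl⟩ := Finset.mem_image.1 hx
      exact hX l)
    (by
      intro i hi
      have := hp1 i (by omega)
      refine ⟨Set.Ioo_subset_Icc_self this.1, ?_⟩
      rw [← hf]; exact this.2.2.le)
    (fun i hi => hp2 i (by omega))
  have hG : 1 ≤ 4 * T ^ (2 * (r + 1) + 1) / (δ * ρ) := by
    rw [one_le_div (by positivity)]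
    have h1 : δ * ρ ≤ 1 := by nlinarith
    have h2 : 1 ≤ T ^ (2 * (r + 1) + 1) := one_le_pow₀ hT
    linarith
  have h3 := pow_le_pow_right₀ hG (by omega : S.card - 1 ≤ r - 1)
  have h4 : ε * T ^ (r + 1) * (4 * T ^ (2 * (r + 1) + 1) / (δ * ρ)) ^ (S.card - 1) ≤
    ε * T ^ (r + 1) * (4 * T ^ (2 * (r + 1) + 1) / (δ * ρ)) ^ (r - 1) := by gcongr
  linarith

lemma small_arith (x t κ a : ℝ) (r q ts R : ℕ) (hr : 1 ≤ r) (hx : 0 < x) (hκ : 0 < κ)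
    (ha : 1 ≤ a)
    (hlt : x * (t ^ R * (4 * t ^ (2 * R + 1) / κ) ^ (r - 1)) < κ) :
    x ^ r / a ^ (2 * R + (2 * (2 * R + 1) + q + 2 * ts) * (r - 1) + 2 * ts) * (t * a ^ 2) ^ R *
      (4 * (t * a ^ 2) ^ (2 * R + 1) / (x / a ^ q * (κ / a ^ (2 * ts)))) ^ (r - 1)
      < κ / a ^ (2 * ts) := by
  have ha0 : 0 < a := by linarith
  obtain ⟨n, rfl⟩ : ∃ n, r = n + 1 := ⟨r - 1, by omega⟩
  simp only [Nat.add_sub_cancel] at *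
  have e1 : 4 * (t * a ^ 2) ^ (2 * R + 1) / (x / a ^ q * (κ / a ^ (2 * ts)))
      = (4 * t ^ (2 * R + 1) / κ) * a ^ (2 * (2 * R + 1) + q + 2 * ts) / x := by
    rw [mul_pow, ← pow_mul, pow_add a _ (2 * ts), pow_add a _ q]
    field_simp
  rw [e1, div_pow, mul_pow (4 * t ^ (2 * R + 1) / κ), ← pow_mul]
  rw [mul_pow t, ← pow_mul, pow_add a (2 * R + _), pow_add a (2 * R) (_ * n), pow_succ x n]
  have h1 : 0 < a ^ (2 * R) := by positivity
  have h2 : 0 < a ^ ((2 * (2 * R + 1) + q + 2 * ts) * n) := by positivity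
  have h3 : 0 < a ^ (2 * ts) := by positivity
  have h4 : 0 < x ^ n := by positivity
  generalize a ^ (2 * R) = A at *
  generalize a ^ ((2 * (2 * R + 1) + q + 2 * ts) * n) = B at *
  generalize a ^ (2 * ts) = D at *
  generalize (4 * t ^ (2 * R + 1) / κ) ^ n = E at *
  generalize t ^ R = F at *
  generalize x ^ n = G at *
  have : G * x / (A * B * D) * (F * A) * (E * B / G) = x * (F * E) / D := by
    field_simp
  rw [this]
  gcongr

/-- all configurations of size at most `N` -/
noncomputable def confs (d r N : ℕ) : Finset ((Fin r → Zd d) × (Fin r → ℤ)) :=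
  (Fintype.piFinset fun _ => Fintype.piFinset fun _ => Finset.Icc (-(N : ℤ)) N) ×ˢ
    (Fintype.piFinset fun _ => {1, -1})

lemma confs_card (d r N : ℕ) (hN : 1 ≤ N) :
    ((confs d r N).card : ℝ) ≤ (3 ^ (d * r) * 2 ^ r) * (N : ℝ) ^ (d * r) := by
  have h : (confs d r N).card = ((2 * N + 1) ^ d) ^ r * 2 ^ r := by
    have h1 : (Finset.Icc (-(N : ℤ)) N).card = 2 * N + 1 := by
      rw [Int.card_Icc]; omega
    have h2 : ({1, -1} : Finset ℤ).card = 2 := by decide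
    unfold confs
    rw [Finset.card_product, Fintype.card_piFinset_const, Fintype.card_piFinset_const,
      Fintype.card_piFinset_const, h1, h2]
  rw [h, ← pow_mul]
  push_cast
  have : (1 : ℝ) ≤ N := by exact_mod_cast hN
  calc (2 * (N : ℝ) + 1) ^ (d * r) * 2 ^ r ≤ (3 * N) ^ (d * r) * 2 ^ r := by
        gcongr; linarith
    _ = _ := by rw [mul_pow]; ring

lemma mem_confs {d r N : ℕ} (j : Fin r → Zd d) (σ : Fin r → ℤ) (hσ : ∀ l, σ l = 1 ∨ σ l = -1)
    (hj : ∀ l, enorm (j l) ≤ (N : ℝ)) : (j, σ) ∈ confs d r N := by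
  unfold confs
  simp only [Finset.mem_product, Fintype.mem_piFinset, Finset.mem_Icc, Finset.mem_insert,
    Finset.mem_singleton]
  refine ⟨fun l i => ?_, hσ⟩
  have := coord_le (j l) N (hj l) i
  rw [← abs_le]
  exact_mod_cast this

lemma T_bounds (y z G0 ζ₁ ζ₂ M : ℝ) (hy : 0 ≤ y) (hG : 0 ≤ G0) (h1 : 0 < ζ₁) (h2 : ζ₁ < ζ₂)
    (hM : 1 ≤ M) (hyM : y ≤ G0 * M) (hz : z ∈ Set.Icc ζ₁ ζ₂) :
    ((G0 + ζ₂ + ζ₁⁻¹ + 1) * M)⁻¹ ≤ y + z ∧ y + z ≤ (G0 + ζ₂ + ζ₁⁻¹ + 1) * M := by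
  have hinv : 0 < ζ₁⁻¹ := inv_pos.2 h1
  have h5 := hz.2
  have a1 : ζ₂ ≤ ζ₂ * M := le_mul_of_one_le_right (by linarith) hM
  have a2 : ζ₁⁻¹ ≤ ζ₁⁻¹ * M := le_mul_of_one_le_right hinv.le hM
  have a3 : 0 ≤ G0 * M := by positivity
  have e : (G0 + ζ₂ + ζ₁⁻¹ + 1) * M = G0 * M + ζ₂ * M + ζ₁⁻¹ * M + M := by ring
  constructor
  · have h4 : ((G0 + ζ₂ + ζ₁⁻¹ + 1) * M)⁻¹ ≤ ζ₁ := inv_le_of_inv_le₀ h1 (by linarith)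
    linarith [hz.1]
  · linarith

set_option maxHeartbeats 2000000 in
/-- Lemma `v.001 idrodinamico`, QHD.
For an admissible `ḡ` there is `τ = τ_r` such that for every small `γ > 0` there is a
measurable `I_γ ⊂ (ζ₁,ζ₂)` with `|(ζ₁,ζ₂) ∖ I_γ| ≤ C γ^{1/r}`, and for `ζ ∈ I_γ` any
nonvanishing combination `Σ σ_l Ω_{j_l}(ζ)` over nonzero sites `|j_l| ≤ N` is
`≥ γ/N^τ`. -/
theorem stmt_18 (d : ℕ) (hd : 1 ≤ d)
    (gbar : Fin d → Fin d → ℝ) (hsym : ∀ i k, gbar i k = gbar k i)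
    (hpos : ∀ x : Fin d → ℝ, x ≠ 0 → 0 < ∑ i, ∑ k, gbar i k * x i * x k)
    (hadm : ∃ γ₀ : ℝ, 0 < γ₀ ∧ Diophantine d gbar γ₀)
    (ζ₁ ζ₂ : ℝ) (hζ₁ : 0 < ζ₁) (hζ₁₂ : ζ₁ < ζ₂) (r : ℕ) (hr : 1 ≤ r) :
    ∃ τ : ℝ, ∃ C : ℝ, 0 < C ∧ ∃ γmax : ℝ, 0 < γmax ∧
      ∀ γ : ℝ, 0 < γ → γ < γmax →
        ∃ I : Set ℝ, MeasurableSet I ∧ I ⊆ Set.Ioo ζ₁ ζ₂ ∧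
          MeasureTheory.volume (Set.Ioo ζ₁ ζ₂ \ I)
            ≤ ENNReal.ofReal (C * γ ^ (1 / (r : ℝ))) ∧
          ∀ ζ ∈ I, ∀ N : ℕ, 1 ≤ N →
            ∀ (j : Fin r → Zd d) (σ : Fin r → ℤ),
              (∀ l, j l ≠ 0) → (∀ l, σ l = 1 ∨ σ l = -1) →
              (∀ l, enorm (j l) ≤ (N : ℝ)) →
              (∑ l, (σ l : ℝ) * qhdFreq d gbar (j l) ζ) ≠ 0 →
              γ / (N : ℝ) ^ τ ≤ |∑ l, (σ l : ℝ) * qhdFreq d gbar (j l) ζ| := by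
  classical
  obtain ⟨γ₀, hγ₀, hD⟩ := hadm
  set ts := tauStar d with hts
  have hd0 : (0 : ℝ) < d := by exact_mod_cast hd
  set κ : ℝ := min 1 (γ₀ / (4 * (d : ℝ) ^ 2) ^ ts) with hκ
  have hκ0 : 0 < κ := lt_min one_pos (by positivity)
  have hκ1 : κ ≤ 1 := min_le_left _ _
  set G0 : ℝ := ∑ i, ∑ k, |gbar i k| with hG0
  have hG0' : 0 ≤ G0 := Finset.sum_nonneg fun i _ => Finset.sum_nonneg fun k _ => abs_nonneg _
  have hζ₂ : 0 < ζ₂ := hζ₁.trans hζ₁₂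
  have hinv : 0 < ζ₁⁻¹ := inv_pos.2 hζ₁
  set t : ℝ := G0 + ζ₂ + ζ₁⁻¹ + 1 with ht
  have ht1 : 1 ≤ t := by linarith
  have ht0 : 0 < t := by linarith
  set q : ℕ := d * r + 2 with hq
  set C1 : ℝ := t ^ (r + 1) * (4 * t ^ (2 * (r + 1) + 1) / κ) ^ (r - 1) with hC1
  have hC10 : 0 < C1 := by positivity
  set τ : ℕ := 2 * (r + 1) + (2 * (2 * (r + 1) + 1) + q + 2 * ts) * (r - 1) + 2 * ts with hτ
  set K : ℝ := (3 ^ (d * r) * 2 ^ r) * (2 * (2 ^ r : ℕ)) with hK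
  have hK0 : 0 < K := by positivity
  have hsum : Summable fun n : ℕ => 1 / ((n + 1 : ℕ) : ℝ) ^ 2 :=
    (summable_nat_add_iff 1).2 (Real.summable_one_div_nat_pow.2 (by norm_num))
  set Z : ℝ := ∑' n : ℕ, 1 / ((n + 1 : ℕ) : ℝ) ^ 2 with hZ
  have hZ0 : 0 ≤ Z := tsum_nonneg fun n => by positivity
  refine ⟨τ, K * Z + 1, by positivity, min 1 ((κ / C1) ^ r), by positivity, ?_⟩
  intro γ hγ hγmax
  have hγ1 : γ ≤ 1 := (hγmax.trans_le (min_le_left _ _)).le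
  have hγ2 : γ < (κ / C1) ^ r := hγmax.trans_le (min_le_right _ _)
  set x : ℝ := γ ^ (1 / (r : ℝ)) with hx
  have hx0 : 0 < x := Real.rpow_pos_of_pos hγ _
  have hxr : x ^ r = γ := by
    rw [hx, one_div]; exact Real.rpow_inv_natCast_pow hγ.le (by omega)
  have hx1 : x ≤ 1 := Real.rpow_le_one hγ.le hγ1 (by positivity)
  have hxC : x * C1 < κ := by
    rw [← lt_div_iff₀ hC10]
    rw [← hxr] at hγ2
    exact lt_of_pow_lt_pow_left₀ r (by positivity) hγ2
  -- the bad sets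
  let f : ((Fin r → Zd d) × (Fin r → ℤ)) → ℝ → ℝ :=
    fun P ζ => ∑ l, (P.2 l : ℝ) * qhdFreq d gbar (P.1 l) ζ
  have hfc : ∀ P, Continuous (f P) := by
    intro P
    simp only [f, qhdFreq]
    fun_prop
  let bad : ℕ → ((Fin r → Zd d) × (Fin r → ℤ)) → Set ℝ := fun N P =>
    {ζ | ζ ∈ Set.Ioo ζ₁ ζ₂ ∧ f P ζ ≠ 0 ∧ |f P ζ| < γ / (N : ℝ) ^ τ}
  have hbadm : ∀ N P, MeasurableSet (bad N P) := by
    intro N P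
    have h1 : MeasurableSet {ζ | f P ζ ≠ 0} := (isOpen_ne_fun (hfc P) continuous_const).measurableSet
    have h2 : MeasurableSet {ζ | |f P ζ| < γ / (N : ℝ) ^ τ} :=
      (isOpen_lt (hfc P).abs continuous_const).measurableSet
    exact measurableSet_Ioo.inter (h1.inter h2)
  let F : ℕ → Finset ((Fin r → Zd d) × (Fin r → ℤ)) := fun N =>
    (confs d r N).filter fun P => (∀ l, P.1 l ≠ 0) ∧ ∀ l, enorm (P.1 l) ≤ (N : ℝ)
  let U : ℕ → Set ℝ := fun N => ⋃ P ∈ F N, bad N P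
  have hUm : ∀ N, MeasurableSet (U N) := fun N =>
    Finset.measurableSet_biUnion _ fun P _ => hbadm N P
  have hsingle : ∀ N : ℕ, 1 ≤ N → ∀ P ∈ F N,
      MeasureTheory.volume (bad N P) ≤ ENNReal.ofReal (2 * (2 ^ r : ℕ) * (x / (N : ℝ) ^ q)) := by
    intro N hN P hP
    obtain ⟨-, hP0, hPN⟩ := Finset.mem_filter.1 hP
    have hN1 : (1 : ℝ) ≤ N := by exact_mod_cast hN
    have hN0 : (0 : ℝ) < N := by linarith
    have hN2 : (1 : ℝ) ≤ (N : ℝ) ^ 2 := one_le_pow₀ hN1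
    have hsepN : ∀ j j' : Zd d, (∀ i, |(j i : ℝ)| ≤ N) → (∀ i, |(j' i : ℝ)| ≤ N) →
        qform d gbar j ≠ qform d gbar j' →
        κ / (N : ℝ) ^ (2 * ts) ≤ |qform d gbar j - qform d gbar j'| := by
      intro j j' h1 h2 h3
      refine le_trans ?_ (dioph_sep hd gbar hsym γ₀ hγ₀ hD N hN j j' h1 h2 h3)
      gcongr
      exact min_le_right _ _
    have hposq : ∀ l, 0 < qform d gbar (P.1 l) := by
      intro l
      refine hpos (fun i => (P.1 l i : ℝ)) ?_
      intro h
      apply hP0 l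
      funext i
      have := congrFun h i
      simpa using this
    have hq0 : qform d gbar 0 = 0 := by simp [qform]
    have hκN : κ / (N : ℝ) ^ (2 * ts) ≤ 1 :=
      (div_le_one (by positivity)).2 (hκ1.trans (one_le_pow₀ hN1))
    have hxN : x / (N : ℝ) ^ q ≤ 1 :=
      (div_le_one (by positivity)).2 (hx1.trans (one_le_pow₀ hN1))
    have hTN : 1 ≤ t * (N : ℝ) ^ 2 := by nlinarith
    refine single_bad gbar P.1 P.2 (x / (N : ℝ) ^ q) (κ / (N : ℝ) ^ (2 * ts)) (t * (N : ℝ) ^ 2)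
      (γ / (N : ℝ) ^ τ) ζ₁ ζ₂ (by positivity) hxN (by positivity) hκN hTN (by positivity)
      ?_ ?_ ?_ ?_
    · intro l
      have := hsepN (P.1 l) 0 (coord_le _ N (hPN l)) (by simp) (by rw [hq0]; exact (hposq l).ne')
      rwa [hq0, sub_zero, abs_of_pos (hposq l)] at this
    · intro l l' hne
      exact hsepN _ _ (coord_le _ N (hPN l)) (coord_le _ N (hPN l')) hne
    · intro l z hz
      have h1 := qform_le gbar N (P.1 l) (coord_le _ N (hPN l))
      have h2 := hposq l
      exact T_bounds _ z G0 ζ₁ ζ₂ _ h2.le hG0' hζ₁ hζ₁₂ hN2 h1 hz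
    · rw [← hxr]
      exact small_arith x t κ N r q ts (r + 1) hr hx0 hκ0 hN1 hxC
  have hUvol : ∀ n : ℕ, MeasureTheory.volume (U (n + 1)) ≤
      ENNReal.ofReal (K * x * (1 / ((n + 1 : ℕ) : ℝ) ^ 2)) := by
    intro n
    have hN1 : (0 : ℝ) < ((n + 1 : ℕ) : ℝ) := by positivity
    calc MeasureTheory.volume (U (n + 1))
        ≤ ∑ P ∈ F (n + 1), MeasureTheory.volume (bad (n + 1) P) :=
          MeasureTheory.measure_biUnion_finset_le _ _
      _ ≤ ∑ P ∈ F (n + 1), ENNReal.ofReal (2 * (2 ^ r : ℕ) * (x / ((n + 1 : ℕ) : ℝ) ^ q)) :=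
          Finset.sum_le_sum fun P hP => hsingle (n + 1) (by omega) P hP
      _ = ENNReal.ofReal ((F (n + 1)).card * (2 * (2 ^ r : ℕ) * (x / ((n + 1 : ℕ) : ℝ) ^ q))) := by
          rw [Finset.sum_const, nsmul_eq_mul, ENNReal.ofReal_mul (Nat.cast_nonneg _),
            ENNReal.ofReal_natCast]
      _ ≤ _ := by
          refine ENNReal.ofReal_le_ofReal ?_
          have hc : ((F (n + 1)).card : ℝ) ≤
              (3 ^ (d * r) * 2 ^ r) * ((n + 1 : ℕ) : ℝ) ^ (d * r) :=
            le_trans (by exact_mod_cast Finset.card_filter_le _ _)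
              (confs_card d r (n + 1) (by omega))
          generalize ((n + 1 : ℕ) : ℝ) = a at *
          calc _ ≤ (3 ^ (d * r) * 2 ^ r) * a ^ (d * r) * (2 * (2 ^ r : ℕ) * (x / a ^ q)) := by
                gcongr
            _ = K * x * (1 / a ^ 2) := by
                rw [hK, hq, pow_add]
                field_simp
  refine ⟨Set.Ioo ζ₁ ζ₂ \ ⋃ n : ℕ, U (n + 1),
    measurableSet_Ioo.diff (MeasurableSet.iUnion fun n => hUm _), Set.diff_subset, ?_, ?_⟩
  · rw [Set.sdiff_sdiff_right_self]
    calc MeasureTheory.volume (Set.Ioo ζ₁ ζ₂ ∩ ⋃ n : ℕ, U (n + 1))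
        ≤ MeasureTheory.volume (⋃ n : ℕ, U (n + 1)) :=
          MeasureTheory.measure_mono Set.inter_subset_right
      _ ≤ ∑' n : ℕ, MeasureTheory.volume (U (n + 1)) := MeasureTheory.measure_iUnion_le _
      _ ≤ ∑' n : ℕ, ENNReal.ofReal (K * x * (1 / ((n + 1 : ℕ) : ℝ) ^ 2)) :=
          ENNReal.tsum_le_tsum hUvol
      _ = ENNReal.ofReal (∑' n : ℕ, K * x * (1 / ((n + 1 : ℕ) : ℝ) ^ 2)) :=
          (ENNReal.ofReal_tsum_of_nonneg (fun n => by positivity) (hsum.mul_left _)).symm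
      _ ≤ _ := by
          refine ENNReal.ofReal_le_ofReal ?_
          rw [tsum_mul_left, ← hZ]
          nlinarith
  · intro ζ hζ N hN j σ hj hσ hjN hne
    by_contra hcon
    push Not at hcon
    rw [Real.rpow_natCast] at hcon
    apply hζ.2
    refine Set.mem_iUnion.2 ⟨N - 1, ?_⟩
    rw [Nat.sub_add_cancel hN]
    refine Set.mem_biUnion (x := (j, σ)) ?_ ?_
    · exact Finset.mem_coe.2 (Finset.mem_filter.2 ⟨mem_confs j σ hσ hjN, hj, hjN⟩)
    · exact ⟨hζ.1, hne, hcon⟩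

end AG
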